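/- arXiv:2309.08024 — 4 statements merged into one kernel-verified Lean document; each statement's English description precedes it below -/
import Mathlib

section
/- Let μ and ν be σ-finite measures on measurable spaces X and Y, let F : L²(X,μ;ℂ) → L²(Y,ν;ℂ) be a unitary operator satisfying additionally F(conj f) = conj(F f) for every f ∈ L²(X,μ;ℂ) (F commutes with pointwise complex conjugation), and let φ : Y → ℂ and ψ : X → ℂ be measurable with Re φ ≥ 0 and Re ψ ≥ 0 pointwise. Let n ≥ 1, real numbers s₀ < s₁ < ⋯ < sₙ and t₀ < t₁ < ⋯ < tₙ, Δs_k := s_{k+1} − s_k, Δt_k := t_{k+1} − t_k, and for 0 ≤ k ≤ n−1 define P_k f := F⁻¹(e^{−Δs_k φ}·(F f)) and Q_k g := F(e^{−Δt_k ψ}·(F⁻¹ g)). Fix f, ℓ ∈ L²(X,μ;ℂ) and set 𝖥 := e^{−Δt₀ψ}·P₀( e^{−Δt₁ψ}·P₁( ⋯ e^{−Δt_{n−1}ψ}·(P_{n−1} f) ⋯ )) ∈ L²(X,μ;ℂ) and 𝖦 := Q₀( e^{−Δs₀φ}·Q₁( ⋯ Q_{n−1}( e^{−Δs_{n−1}φ}·(F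 f)) ⋯ )) ∈ L²(Y,ν;ℂ). Then ∫_X 𝖥(x)·ℓ(x) dμ(x) = ∫_Y 𝖦(y)·(Fℓ)(y) dν(y), both integrands being integrable as products of two L² functions. -/
open MeasureTheory

/-- An isometric isomorphism of complex `L²` spaces that commutes with pointwise conjugation
preserves the bilinear pairing `∫ u * v`. -/
theorem integral_mul_eq_of_comm_conj {X Y : Type*} [MeasurableSpace X] [MeasurableSpace Y]
    {μ : Measure X} {ν : Measure Y} (F : Lp ℂ 2 μ ≃ₗᵢ[ℂ] Lp ℂ 2 ν)
    (hconj : ∀ u v : Lp ℂ 2 μ,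
      ((v : X → ℂ) =ᵐ[μ] fun x => (starRingEnd ℂ) ((u : X → ℂ) x)) →
      ((F v : Y → ℂ) =ᵐ[ν] fun y => (starRingEnd ℂ) ((F u : Y → ℂ) y)))
    (u v : Lp ℂ 2 μ) :
    ∫ x, (u : X → ℂ) x * (v : X → ℂ) x ∂μ = ∫ y, (F u : Y → ℂ) y * (F v : Y → ℂ) y ∂ν := by
  have hu : ((star u : Lp ℂ 2 μ) : X → ℂ) =ᵐ[μ] fun x => (starRingEnd ℂ) ((u : X → ℂ) x) :=
    Lp.coeFn_star u
  calc ∫ x, (u : X → ℂ) x * (v : X → ℂ) x ∂μ = inner ℂ (star u) v := by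
        rw [L2.inner_def]
        refine integral_congr_ae ?_
        filter_upwards [hu] with x hx
        simp [hx, mul_comm]
    _ = inner ℂ (F (star u)) (F v) := (F.inner_map_map _ _).symm
    _ = ∫ y, (F u : Y → ℂ) y * (F v : Y → ℂ) y ∂ν := by
        rw [L2.inner_def]
        refine integral_congr_ae ?_
        filter_upwards [hconj u (star u) hu] with y hy
        simp [hy, mul_comm]

/-- Operator form of the corollary on dual representations with initial laws:
with `𝖥 = e^{−Δt₀ψ}·P₀(⋯ (P_{n−1} f) ⋯)` and `𝖦 = Q₀(e^{−Δs₀φ}·Q₁(⋯ (F f) ⋯))`,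
and `F` commuting with pointwise conjugation, one has
`∫ 𝖥·ℓ dμ = ∫ 𝖦·(Fℓ) dν`, both integrands being integrable. -/
theorem statement2 {X Y : Type*} [MeasurableSpace X] [MeasurableSpace Y]
    {μ : Measure X} {ν : Measure Y} [SigmaFinite μ] [SigmaFinite ν]
    (F : Lp ℂ 2 μ ≃ₗᵢ[ℂ] Lp ℂ 2 ν)
    (hconj : ∀ u v : Lp ℂ 2 μ,
      ((v : X → ℂ) =ᵐ[μ] fun x => (starRingEnd ℂ) ((u : X → ℂ) x)) →
      ((F v : Y → ℂ) =ᵐ[ν] fun y => (starRingEnd ℂ) ((F u : Y → ℂ) y)))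
    (φ : Y → ℂ) (ψ : X → ℂ) (hφ : Measurable φ) (hψ : Measurable ψ)
    (hφre : ∀ y, 0 ≤ (φ y).re) (hψre : ∀ x, 0 ≤ (ψ x).re)
    (n : ℕ) (hn : 1 ≤ n)
    (s t : Fin (n + 1) → ℝ) (hs : StrictMono s) (ht : StrictMono t)
    (A : Fin n → Lp ℂ 2 μ → Lp ℂ 2 μ) (B : Fin n → Lp ℂ 2 ν → Lp ℂ 2 ν)
    (hA : ∀ (k : Fin n) (u : Lp ℂ 2 μ),
      (A k u : X → ℂ) =ᵐ[μ]
        fun x => Complex.exp (-((t k.succ - t k.castSucc : ℝ) : ℂ) * ψ x) * (u : X → ℂ) x)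
    (hB : ∀ (k : Fin n) (v : Lp ℂ 2 ν),
      (B k v : Y → ℂ) =ᵐ[ν]
        fun y => Complex.exp (-((s k.succ - s k.castSucc : ℝ) : ℂ) * φ y) * (v : Y → ℂ) y)
    (P : Fin n → Lp ℂ 2 μ → Lp ℂ 2 μ) (hP : ∀ k u, P k u = F.symm (B k (F u)))
    (Q : Fin n → Lp ℂ 2 ν → Lp ℂ 2 ν) (hQ : ∀ k v, Q k v = F (A k (F.symm v)))
    (f ℓ : Lp ℂ 2 μ) :
    Integrable
      (fun x =>
        (((List.finRange n).foldr (fun k u => A k (P k u)) f : Lp ℂ 2 μ) : X → ℂ) x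
          * (ℓ : X → ℂ) x) μ ∧
    Integrable
      (fun y =>
        (((List.finRange n).foldr (fun k v => Q k (B k v)) (F f) : Lp ℂ 2 ν) : Y → ℂ) y
          * (F ℓ : Y → ℂ) y) ν ∧
    ∫ x, (((List.finRange n).foldr (fun k u => A k (P k u)) f : Lp ℂ 2 μ) : X → ℂ) x
          * (ℓ : X → ℂ) x ∂μ
      = ∫ y, (((List.finRange n).foldr (fun k v => Q k (B k v)) (F f) : Lp ℂ 2 ν) : Y → ℂ) y
          * (F ℓ : Y → ℂ) y ∂ν := by
  have hfold : (List.finRange n).foldr (fun k v => Q k (B k v)) (F f)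
      = F ((List.finRange n).foldr (fun k u => A k (P k u)) f) :=
    List.foldr_hom F fun k u => by simp [hP, hQ]
  rw [hfold]
  exact ⟨(Lp.memLp _).integrable_mul (Lp.memLp _), (Lp.memLp _).integrable_mul (Lp.memLp _),
    integral_mul_eq_of_comm_conj F hconj _ ℓ⟩
end

section
/- Let n ≥ 1, let 0 = s̃₀ < s̃₁ < ⋯ < s̃ₙ < s̃_{n+1} = 1 and 0 = t₀ < t₁ < ⋯ < tₙ be real numbers. Then the following identity of absolutely convergent Lebesgue integrals holds: ∫_{(0,∞)ⁿ} exp(−Σ_{k=1}^{n} (t_k − t_{k−1}) x_k) · √(8π) h_{s̃₁}(x₁) h_{1−s̃₁}(x₁) · Π_{k=1}^{n−1} [ (h_{s̃_{k+1}}(x_{k+1}) / h_{s̃_k}(x_k)) · p̃_{s̃_{k+1}−s̃_k}(x_k, x_{k+1}) ] dx₁⋯dxₙ = √(2/π) ∫_{(0,∞)^{n+1}} exp(−(1/2) Σ_{k=0}^{n} (s̃_{k+1} − s̃_k) y_k²) · Π_{k=1}^{n} q_{t_k − t_{k−1}}(y_{k−1}, y_k) · y₀² dy₀ dy₁⋯dyₙ.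 (The left side is the joint Laplace transform E[exp(−Σ_{k=1}^n (t_k−t_{k−1}) B^{ex}_{s̃_k})] of the normalized Brownian excursion, and the right side is the dual representation in terms of the radial part of a three-dimensional Cauchy process.) -/
open MeasureTheory

/-- Transition subprobability density of Brownian motion killed at 0. -/
noncomputable def ptilde (t x₁ x₂ : ℝ) : ℝ :=
  (Real.sqrt (2 * Real.pi * t))⁻¹ *
    (Real.exp (-(x₁ - x₂) ^ 2 / (2 * t)) - Real.exp (-(x₁ + x₂) ^ 2 / (2 * t)))

/-- `h_s(x) = x·(2π(1−s)³)^{−1/2}·exp(−x²/(2(1−s)))`. -/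
noncomputable def hexc (s x : ℝ) : ℝ :=
  x / Real.sqrt (2 * Real.pi * (1 - s) ^ 3) * Real.exp (-x ^ 2 / (2 * (1 - s)))

/-- Transition density of the radial part of a three-dimensional Cauchy process. -/
noncomputable def qrad (t y₁ y₂ : ℝ) : ℝ :=
  (y₂ / y₁) * (1 / Real.pi) *
    (t / (t ^ 2 + (y₁ - y₂) ^ 2) - t / (t ^ 2 + (y₁ + y₂) ^ 2))

/-- Extension of a vector `x : Fin n → ℝ` to a function on `ℕ` (by zero). -/
def ext (n : ℕ) (x : Fin n → ℝ) (k : ℕ) : ℝ := if h : k < n then x ⟨k, h⟩ else 0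

lemma integrableOn_exp_neg_mul_cos {c : ℝ} (hc : 0 < c) (a : ℝ) :
    IntegrableOn (fun x => Real.exp (-(c * x)) * Real.cos (a * x)) (Set.Ioi 0) := by
  refine Integrable.mono' (exp_neg_integrableOn_Ioi 0 hc)
    (by fun_prop) (Filter.Eventually.of_forall fun x => ?_)
  rw [Real.norm_eq_abs, abs_mul, Real.abs_exp, neg_mul]
  exact mul_le_of_le_one_right (Real.exp_pos _).le (Real.abs_cos_le_one _)

/-- The Laplace transform of a cosine. -/
lemma integral_exp_neg_mul_cos {c : ℝ} (hc : 0 < c) (a : ℝ) :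
    ∫ x in Set.Ioi (0 : ℝ), Real.exp (-(c * x)) * Real.cos (a * x) = c / (c ^ 2 + a ^ 2) := by
  have hne : c ^ 2 + a ^ 2 ≠ 0 := by positivity
  have hderiv : ∀ x ∈ Set.Ici (0 : ℝ), HasDerivAt
      (fun x => Real.exp (-(c * x)) * ((a * Real.sin (a * x) - c * Real.cos (a * x)) /
        (c ^ 2 + a ^ 2))) (Real.exp (-(c * x)) * Real.cos (a * x)) x := by
    intro x _
    have h1 : HasDerivAt (fun x : ℝ => a * x) a x := by
      simpa using (hasDerivAt_id x).const_mul a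
    have h2 : HasDerivAt (fun x : ℝ => -(c * x)) (-c) x := by
      simpa using ((hasDerivAt_id x).const_mul c).fun_neg
    refine (h2.exp.mul (((h1.sin.const_mul a).fun_sub (h1.cos.const_mul c)).div_const
      (c ^ 2 + a ^ 2))).congr_deriv ?_
    field_simp
    ring
  have hlim : Filter.Tendsto (fun x => Real.exp (-(c * x)) *
      ((a * Real.sin (a * x) - c * Real.cos (a * x)) / (c ^ 2 + a ^ 2))) Filter.atTop (nhds 0) := by
    refine Filter.Tendsto.zero_mul_isBoundedUnder_le ?_ ?_
    · exact Real.tendsto_exp_neg_atTop_nhds_zero.comp (Filter.tendsto_id.const_mul_atTop hc)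
    · refine Filter.isBoundedUnder_of ⟨(|a| + |c|) / (c ^ 2 + a ^ 2), fun x => ?_⟩
      have hpos : 0 < c ^ 2 + a ^ 2 := by positivity
      simp only [Function.comp_apply, Real.norm_eq_abs, abs_div, abs_of_pos hpos]
      gcongr
      refine (abs_sub _ _).trans ?_
      rw [abs_mul, abs_mul]
      gcongr
      · exact mul_le_of_le_one_right (abs_nonneg _) (Real.abs_sin_le_one _)
      · exact mul_le_of_le_one_right (abs_nonneg _) (Real.abs_cos_le_one _)
  rw [integral_Ioi_of_hasDerivAt_of_tendsto' hderiv (integrableOn_exp_neg_mul_cos hc a) hlim]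
  simp
  ring

lemma integrableOn_exp_neg_sq_cos {u : ℝ} (hu : 0 < u) (a : ℝ) :
    IntegrableOn (fun y => Real.exp (-(u / 2 * y ^ 2)) * Real.cos (a * y)) (Set.Ioi 0) := by
  refine Integrable.mono' (integrable_exp_neg_mul_sq (half_pos hu)).integrableOn
    (by fun_prop) (Filter.Eventually.of_forall fun x => ?_)
  rw [Real.norm_eq_abs, abs_mul, Real.abs_exp, neg_mul]
  exact mul_le_of_le_one_right (Real.exp_pos _).le (Real.abs_cos_le_one _)

/-- The cosine transform of a Gaussian. -/
lemma integral_exp_neg_sq_cos {u : ℝ} (hu : 0 < u) (a : ℝ) :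
    ∫ y in Set.Ioi (0 : ℝ), Real.exp (-(u / 2 * y ^ 2)) * Real.cos (a * y) =
      Real.pi / Real.sqrt (2 * Real.pi * u) * Real.exp (-a ^ 2 / (2 * u)) := by
  have hF := fourierIntegral_gaussian (b := ((u / 2 : ℝ) : ℂ)) (by simpa using hu) (a : ℂ)
  have hre : ∫ y : ℝ, Real.exp (-(u / 2 * y ^ 2)) * Real.cos (a * y) =
      Real.sqrt (Real.pi / (u / 2)) * Real.exp (-a ^ 2 / (2 * u)) := by
    have hcongr : ∀ y : ℝ, Complex.exp (Complex.I * a * y) *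
        Complex.exp (-((u / 2 : ℝ) : ℂ) * y ^ 2) =
        Complex.exp ((-(u / 2 * y ^ 2) : ℝ) + ((a * y : ℝ) : ℂ) * Complex.I) := by
      intro y
      rw [← Complex.exp_add]
      congr 1
      push_cast
      ring
    have hint : Integrable (fun y : ℝ =>
        Complex.exp ((-(u / 2 * y ^ 2) : ℝ) + ((a * y : ℝ) : ℂ) * Complex.I)) := by
      refine Integrable.mono' (integrable_exp_neg_mul_sq (half_pos hu))
        (by fun_prop) (Filter.Eventually.of_forall fun x => ?_)
      rw [Complex.norm_exp, Complex.add_re, Complex.ofReal_re, Complex.re_ofReal_mul,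
        Complex.I_re, mul_zero, add_zero, neg_mul]
    simp_rw [hcongr] at hF
    have hR := congrArg Complex.re hF
    rw [← RCLike.re_eq_complex_re, ← integral_re hint] at hR
    have hl : ∀ y : ℝ, RCLike.re (Complex.exp ((-(u / 2 * y ^ 2) : ℝ) +
        ((a * y : ℝ) : ℂ) * Complex.I)) = Real.exp (-(u / 2 * y ^ 2)) * Real.cos (a * y) := by
      intro y
      rw [RCLike.re_eq_complex_re, Complex.exp_re]
      simp [-Complex.ofReal_mul, -Complex.ofReal_neg]
    simp_rw [hl] at hR
    rw [hR]
    have hr : ((Real.pi : ℂ) / ((u / 2 : ℝ) : ℂ)) ^ (1 / 2 : ℂ) *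
        Complex.exp (-(a : ℂ) ^ 2 / (4 * ((u / 2 : ℝ) : ℂ))) =
        ((Real.sqrt (Real.pi / (u / 2)) * Real.exp (-a ^ 2 / (2 * u)) : ℝ) : ℂ) := by
      rw [Real.sqrt_eq_rpow, Complex.ofReal_mul, Complex.ofReal_cpow (by positivity)]
      push_cast
      congr 2
      congr 1
      ring
    rw [hr, RCLike.re_eq_complex_re, Complex.ofReal_re]
  have habs := integral_comp_abs (f := fun y => Real.exp (-(u / 2 * y ^ 2)) * Real.cos (a * y))
  have heven : ∀ y : ℝ, Real.exp (-(u / 2 * |y| ^ 2)) * Real.cos (a * |y|) =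
      Real.exp (-(u / 2 * y ^ 2)) * Real.cos (a * y) := by
    intro y
    rw [sq_abs]
    rcases abs_choice y with h | h <;> simp [h]
  simp_rw [heven] at habs
  rw [hre] at habs
  have hs : Real.sqrt (Real.pi / (u / 2)) = 2 * (Real.pi / Real.sqrt (2 * Real.pi * u)) := by
    rw [Real.sqrt_eq_iff_mul_self_eq_of_pos (by positivity)]
    field_simp
    rw [Real.sq_sqrt (by positivity)]
  rw [hs] at habs
  linarith

/-- Spectral representation of the killed heat kernel. -/
lemma integral_exp_neg_sq_sin_sin {u : ℝ} (hu : 0 < u) (a b : ℝ) :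
    ∫ y in Set.Ioi (0 : ℝ), Real.exp (-(u / 2 * y ^ 2)) * Real.sin (a * y) * Real.sin (b * y) =
      Real.pi / 2 * ((Real.sqrt (2 * Real.pi * u))⁻¹ *
        (Real.exp (-(a - b) ^ 2 / (2 * u)) - Real.exp (-(a + b) ^ 2 / (2 * u)))) := by
  have h : ∀ y : ℝ, Real.exp (-(u / 2 * y ^ 2)) * Real.sin (a * y) * Real.sin (b * y) =
      (1 / 2) * (Real.exp (-(u / 2 * y ^ 2)) * Real.cos ((a - b) * y) -
        Real.exp (-(u / 2 * y ^ 2)) * Real.cos ((a + b) * y)) := by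
    intro y
    rw [sub_mul, add_mul, Real.cos_sub, Real.cos_add]
    ring
  simp_rw [h]
  rw [integral_const_mul, integral_sub (integrableOn_exp_neg_sq_cos hu _)
    (integrableOn_exp_neg_sq_cos hu _), integral_exp_neg_sq_cos hu, integral_exp_neg_sq_cos hu]
  ring

lemma integral_mul_exp_neg_sq_sin {u : ℝ} (hu : 0 < u) (a : ℝ) :
    ∫ y in Set.Ioi (0 : ℝ), Real.exp (-(u / 2 * y ^ 2)) * y * Real.sin (a * y) =
      Real.pi * (a / Real.sqrt (2 * Real.pi * u ^ 3) * Real.exp (-a ^ 2 / (2 * u))) := by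
  have hcos := integrableOn_exp_neg_sq_cos hu a
  have hsin : IntegrableOn (fun y => Real.exp (-(u / 2 * y ^ 2)) * y * Real.sin (a * y))
      (Set.Ioi 0) := by
    refine Integrable.mono' (integrable_mul_exp_neg_mul_sq (half_pos hu)).norm.integrableOn
      (by fun_prop) (Filter.Eventually.of_forall fun x => ?_)
    rw [norm_mul, mul_comm (Real.exp _), neg_mul]
    exact mul_le_of_le_one_right (norm_nonneg _) (Real.abs_sin_le_one _)
  have hderiv : ∀ y ∈ Set.Ici (0 : ℝ), HasDerivAt
      (fun y => Real.exp (-(u / 2 * y ^ 2)) * (-(1 / u) * Real.sin (a * y)))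
      (Real.exp (-(u / 2 * y ^ 2)) * y * Real.sin (a * y) -
        a / u * (Real.exp (-(u / 2 * y ^ 2)) * Real.cos (a * y))) y := by
    intro y _
    have h1 : HasDerivAt (fun x : ℝ => a * x) a y := by
      simpa using (hasDerivAt_id y).const_mul a
    have h2 : HasDerivAt (fun y : ℝ => -(u / 2 * y ^ 2)) (-(u * y)) y := by
      refine ((hasDerivAt_pow 2 y).const_mul (u / 2)).neg.congr_deriv ?_
      simp
      ring
    refine (h2.exp.mul (h1.sin.const_mul (-(1 / u)))).congr_deriv ?_
    field_simp
    ring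
  have hlim : Filter.Tendsto (fun y => Real.exp (-(u / 2 * y ^ 2)) *
      (-(1 / u) * Real.sin (a * y))) Filter.atTop (nhds 0) := by
    refine Filter.Tendsto.zero_mul_isBoundedUnder_le ?_ ?_
    · exact Real.tendsto_exp_neg_atTop_nhds_zero.comp
        ((Filter.tendsto_pow_atTop two_ne_zero).const_mul_atTop (half_pos hu))
    · refine Filter.isBoundedUnder_of ⟨|(-(1 / u))|, fun x => ?_⟩
      simp only [Function.comp_apply, Real.norm_eq_abs, abs_mul]
      exact mul_le_of_le_one_right (abs_nonneg _) (Real.abs_sin_le_one _)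
  have hI := integral_Ioi_of_hasDerivAt_of_tendsto' hderiv (hsin.sub (hcos.const_mul _)) hlim
  rw [integral_sub hsin (hcos.const_mul _), integral_const_mul, integral_exp_neg_sq_cos hu] at hI
  have hs : Real.sqrt (2 * Real.pi * u ^ 3) = u * Real.sqrt (2 * Real.pi * u) := by
    rw [show 2 * Real.pi * u ^ 3 = u ^ 2 * (2 * Real.pi * u) by ring,
      Real.sqrt_mul (by positivity), Real.sqrt_sq hu.le]
  simp only [mul_zero, Real.sin_zero, sub_zero] at hI
  rw [hs, sub_eq_zero.mp hI]
  field_simp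

lemma integral_exp_neg_mul_sin_sin {c : ℝ} (hc : 0 < c) (a b : ℝ) :
    ∫ x in Set.Ioi (0 : ℝ), Real.exp (-(c * x)) * Real.sin (x * a) * Real.sin (x * b) =
      (1 / 2) * (c / (c ^ 2 + (a - b) ^ 2) - c / (c ^ 2 + (a + b) ^ 2)) := by
  have h : ∀ x : ℝ, Real.exp (-(c * x)) * Real.sin (x * a) * Real.sin (x * b) =
      (1 / 2) * (Real.exp (-(c * x)) * Real.cos ((a - b) * x) -
        Real.exp (-(c * x)) * Real.cos ((a + b) * x)) := by
    intro x
    rw [sub_mul, add_mul, Real.cos_sub, Real.cos_add, mul_comm x a, mul_comm x b]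
    ring
  simp_rw [h]
  rw [integral_const_mul, integral_sub (integrableOn_exp_neg_mul_cos hc _)
    (integrableOn_exp_neg_mul_cos hc _), integral_exp_neg_mul_cos hc, integral_exp_neg_mul_cos hc]

lemma ext_coe {n : ℕ} (x : Fin n → ℝ) (i : Fin n) : ext n x i = x i := by
  simp [ext]

lemma continuous_ext (n k : ℕ) : Continuous fun x : Fin n → ℝ => ext n x k := by
  unfold ext
  split_ifs <;> fun_prop

lemma ae_ext_pos (n : ℕ) :
    ∀ᵐ x ∂(Measure.pi fun _ : Fin n => volume.restrict (Set.Ioi (0 : ℝ))),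
      ∀ k < n, 0 < ext n x k := by
  have h : ∀ i : Fin n, ∀ᵐ x ∂(Measure.pi fun _ : Fin n => volume.restrict (Set.Ioi (0 : ℝ))),
      0 < x i := fun i =>
    Measure.tendsto_eval_ae_ae.eventually (ae_restrict_mem measurableSet_Ioi)
  filter_upwards [ae_all_iff.mpr h] with x hx k hk
  rw [ext, dif_pos hk]
  exact hx _

/-- The common integrand whose two partial integrals are the two sides of the duality. -/
noncomputable def dualKernel (n : ℕ) (u c : ℕ → ℝ) (x : Fin n → ℝ) (y : Fin (n + 1) → ℝ) : ℝ :=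
  (∏ k ∈ Finset.range (n + 1), Real.exp (-(u k / 2 * ext (n + 1) y k ^ 2))) *
    (ext (n + 1) y 0 * ext (n + 1) y n) *
    ∏ k ∈ Finset.range n, (Real.exp (-(c k * ext n x k)) *
      Real.sin (ext n x k * ext (n + 1) y k) * Real.sin (ext n x k * ext (n + 1) y (k + 1)))

lemma continuous_dualKernel (n : ℕ) (u c : ℕ → ℝ) :
    Continuous fun z : (Fin n → ℝ) × (Fin (n + 1) → ℝ) => dualKernel n u c z.1 z.2 := by
  have hx : ∀ k, Continuous fun z : (Fin n → ℝ) × (Fin (n + 1) → ℝ) => ext n z.1 k :=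
    fun k => (continuous_ext n k).comp continuous_fst
  have hy : ∀ k, Continuous fun z : (Fin n → ℝ) × (Fin (n + 1) → ℝ) => ext (n + 1) z.2 k :=
    fun k => (continuous_ext (n + 1) k).comp continuous_snd
  unfold dualKernel
  fun_prop

lemma integrable_dualKernel {n : ℕ} (hn : 1 ≤ n) {u c : ℕ → ℝ} (hu : ∀ k ≤ n, 0 < u k)
    (hc : ∀ k < n, 0 < c k) :
    Integrable (fun z : (Fin n → ℝ) × (Fin (n + 1) → ℝ) => dualKernel n u c z.1 z.2)
      ((Measure.pi fun _ => volume.restrict (Set.Ioi (0 : ℝ))).prod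
        (Measure.pi fun _ => volume.restrict (Set.Ioi (0 : ℝ)))) := by
  have hX : Integrable (fun x : Fin n → ℝ => ∏ i : Fin n, Real.exp (-(c i) * x i))
      (Measure.pi fun _ => volume.restrict (Set.Ioi (0 : ℝ))) :=
    Integrable.fintype_prod (f := fun (i : Fin n) z => Real.exp (-(c i) * z)) fun i =>
      exp_neg_integrableOn_Ioi 0 (hc i i.2)
  have hY : Integrable (fun y : Fin (n + 1) → ℝ => ∏ i : Fin (n + 1),
      ((if (i : ℕ) = 0 then y i else 1) * (if (i : ℕ) = n then y i else 1) *
        Real.exp (-(u i / 2) * y i ^ 2)))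
      (Measure.pi fun _ => volume.restrict (Set.Ioi (0 : ℝ))) := by
    refine Integrable.fintype_prod (f := fun (i : Fin (n + 1)) z =>
      ((if (i : ℕ) = 0 then z else 1) * (if (i : ℕ) = n then z else 1) *
        Real.exp (-(u i / 2) * z ^ 2))) fun i => ?_
    have hui : 0 < u i / 2 := half_pos (hu i (Nat.lt_succ_iff.mp i.2))
    have h0 := (integrable_exp_neg_mul_sq hui).restrict (s := Set.Ioi 0)
    have h1 := (integrable_mul_exp_neg_mul_sq hui).restrict (s := Set.Ioi 0)
    by_cases hi0 : (i : ℕ) = 0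
    · have hin : (i : ℕ) ≠ n := by omega
      simpa only [if_pos hi0, if_neg hin, mul_one] using h1
    · by_cases hin : (i : ℕ) = n
      · simpa only [if_neg hi0, if_pos hin, one_mul] using h1
      · simpa only [if_neg hi0, if_neg hin, one_mul] using h0
  refine (hX.mul_prod hY).norm.mono' (continuous_dualKernel n u c).aestronglyMeasurable
    (Filter.Eventually.of_forall fun z => ?_)
  obtain ⟨x, y⟩ := z
  have hx : ∏ i : Fin n, Real.exp (-(c i) * x i) =
      ∏ k ∈ Finset.range n, Real.exp (-(c k * ext n x k)) := by
    simp [Finset.prod_range, ext_coe]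
  have hy : ∏ i : Fin (n + 1), ((if (i : ℕ) = 0 then y i else 1) *
      (if (i : ℕ) = n then y i else 1) * Real.exp (-(u i / 2) * y i ^ 2)) =
      (∏ k ∈ Finset.range (n + 1), Real.exp (-(u k / 2 * ext (n + 1) y k ^ 2))) *
        (ext (n + 1) y 0 * ext (n + 1) y n) := by
    have hr := Finset.prod_range (n := n + 1) fun k =>
      (if k = 0 then ext (n + 1) y k else 1) * (if k = n then ext (n + 1) y k else 1) *
        Real.exp (-(u k / 2) * ext (n + 1) y k ^ 2)
    simp only [ext_coe] at hr
    rw [← hr, Finset.prod_mul_distrib, Finset.prod_mul_distrib, Finset.prod_ite_eq',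
      Finset.prod_ite_eq', if_pos (by simp), if_pos (by simp)]
    simp only [neg_mul]
    ring
  simp only [hx, hy, dualKernel, norm_mul, Finset.prod_mul_distrib]
  have hsin : ∀ f : ℕ → ℝ, ‖∏ k ∈ Finset.range n, Real.sin (f k)‖ ≤ 1 := fun f => by
    rw [norm_prod]
    exact Finset.prod_le_one (fun _ _ => norm_nonneg _) fun _ _ => Real.abs_sin_le_one _
  refine (mul_le_mul_of_nonneg_left ?_ (by positivity)).trans_eq (mul_comm _ _)
  refine (mul_le_of_le_one_right (by positivity) (hsin _)).trans ?_
  exact mul_le_of_le_one_right (norm_nonneg _) (hsin _)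

lemma integral_dualKernel_right (m : ℕ) {u : ℕ → ℝ} (hu : ∀ k ≤ m + 1, 0 < u k) (c : ℕ → ℝ)
    (x : Fin (m + 1) → ℝ) :
    ∫ y, dualKernel (m + 1) u c x y
        ∂(Measure.pi fun _ : Fin (m + 1 + 1) => volume.restrict (Set.Ioi (0 : ℝ))) =
      (∏ k ∈ Finset.range (m + 1), Real.exp (-(c k * ext (m + 1) x k))) *
        ((∏ k ∈ Finset.range m, (Real.pi / 2 *
            ptilde (u (k + 1)) (ext (m + 1) x k) (ext (m + 1) x (k + 1)))) *
          (Real.pi * hexc (1 - u 0) (ext (m + 1) x 0)) *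
          (Real.pi * hexc (1 - u (m + 1)) (ext (m + 1) x m))) := by
  set X := ext (m + 1) x
  let φ : ℕ → ℝ → ℝ := fun k z => Real.exp (-(u k / 2 * z ^ 2)) *
    (if k = 0 then z else Real.sin (X (k - 1) * z)) *
    (if k = m + 1 then z else Real.sin (X k * z))
  have hprod : ∀ y, dualKernel (m + 1) u c x y =
      (∏ k ∈ Finset.range (m + 1), Real.exp (-(c k * X k))) *
        ∏ i : Fin (m + 1 + 1), φ i (y i) := by
    intro y
    have hr := Finset.prod_range (n := m + 1 + 1) fun k => φ k (ext (m + 1 + 1) y k)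
    simp only [ext_coe] at hr
    rw [← hr]
    simp only [dualKernel, φ, Finset.prod_mul_distrib]
    rw [Finset.prod_range_succ' (fun k => if k = 0 then _ else _),
      Finset.prod_range_succ (fun k => if k = m + 1 then _ else _)]
    have h1 : ∏ k ∈ Finset.range (m + 1), (if k + 1 = 0 then ext (m + 1 + 1) y (k + 1) else
        Real.sin (X (k + 1 - 1) * ext (m + 1 + 1) y (k + 1))) =
        ∏ k ∈ Finset.range (m + 1), Real.sin (X k * ext (m + 1 + 1) y (k + 1)) := by
      simp
    have h2 : ∏ k ∈ Finset.range (m + 1), (if k = m + 1 then ext (m + 1 + 1) y k else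
        Real.sin (X k * ext (m + 1 + 1) y k)) =
        ∏ k ∈ Finset.range (m + 1), Real.sin (X k * ext (m + 1 + 1) y k) :=
      Finset.prod_congr rfl fun k hk => if_neg (Finset.mem_range.mp hk).ne
    rw [h1, h2, if_pos rfl, if_pos rfl]
    ring
  simp_rw [hprod]
  rw [integral_const_mul, integral_fintype_prod_eq_prod (fun (i : Fin (m + 1 + 1)) z => φ i z),
    ← Finset.prod_range (fun k => ∫ z in Set.Ioi (0 : ℝ), φ k z),
    Finset.prod_range_succ (fun k => ∫ z in Set.Ioi (0 : ℝ), φ k z),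
    Finset.prod_range_succ' (fun k => ∫ z in Set.Ioi (0 : ℝ), φ k z)]
  refine congrArg₂ (· * ·) rfl (congrArg₂ (· * ·) (congrArg₂ (· * ·) ?_ ?_) ?_)
  · refine Finset.prod_congr rfl fun k hk => ?_
    have hk' := Finset.mem_range.mp hk
    rw [ptilde, ← integral_exp_neg_sq_sin_sin (hu (k + 1) (by omega))]
    simp [φ, hk'.ne]
  · rw [hexc, sub_sub_cancel, ← integral_mul_exp_neg_sq_sin (hu 0 (by omega))]
    simp [φ]
  · rw [hexc, sub_sub_cancel, ← integral_mul_exp_neg_sq_sin (hu (m + 1) le_rfl)]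
    simp only [φ, if_pos, Nat.add_sub_cancel, Nat.succ_ne_zero, if_false]
    congr 1
    funext z
    ring

lemma integral_dualKernel_left (n : ℕ) (u : ℕ → ℝ) {c : ℕ → ℝ} (hc : ∀ k < n, 0 < c k)
    (y : Fin (n + 1) → ℝ) :
    ∫ x, dualKernel n u c x y
        ∂(Measure.pi fun _ : Fin n => volume.restrict (Set.Ioi (0 : ℝ))) =
      (∏ k ∈ Finset.range (n + 1), Real.exp (-(u k / 2 * ext (n + 1) y k ^ 2))) *
        (ext (n + 1) y 0 * ext (n + 1) y n) *
        ∏ k ∈ Finset.range n, ((1 / 2) *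
          (c k / (c k ^ 2 + (ext (n + 1) y k - ext (n + 1) y (k + 1)) ^ 2) -
            c k / (c k ^ 2 + (ext (n + 1) y k + ext (n + 1) y (k + 1)) ^ 2))) := by
  set Y := ext (n + 1) y
  let ψ : ℕ → ℝ → ℝ := fun k z =>
    Real.exp (-(c k * z)) * Real.sin (z * Y k) * Real.sin (z * Y (k + 1))
  have hprod : ∀ x, dualKernel n u c x y =
      (∏ k ∈ Finset.range (n + 1), Real.exp (-(u k / 2 * Y k ^ 2))) * (Y 0 * Y n) *
        ∏ i : Fin n, ψ i (x i) := by
    intro x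
    have hr := Finset.prod_range (n := n) fun k => ψ k (ext n x k)
    simp only [ext_coe] at hr
    rw [← hr]
    rfl
  simp_rw [hprod]
  rw [integral_const_mul, integral_fintype_prod_eq_prod (fun (i : Fin n) z => ψ i z),
    ← Finset.prod_range (fun k => ∫ z in Set.Ioi (0 : ℝ), ψ k z)]
  congr 1
  exact Finset.prod_congr rfl fun k hk =>
    integral_exp_neg_mul_sin_sin (hc k (Finset.mem_range.mp hk)) _ _

lemma mul_prod_range_div_telescope {f : ℕ → ℝ} {m : ℕ} (hf : ∀ k < m, f k ≠ 0) :
    f 0 * ∏ k ∈ Finset.range m, f (k + 1) / f k = f m := by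
  induction m with
  | zero => simp
  | succ m ih =>
    rw [Finset.prod_range_succ, ← mul_assoc, ih fun k hk => hf k (by omega)]
    exact mul_div_cancel₀ _ (hf m (by omega))

lemma hexc_ne_zero {s x : ℝ} (hs : s < 1) (hx : 0 < x) : hexc s x ≠ 0 := by
  have : 0 < 1 - s := sub_pos.mpr hs
  unfold hexc
  positivity

/-- Dual representation of the Laplace transform of the normalized Brownian excursion:
`E[exp(−Σₖ(tₖ−tₖ₋₁)B^{ex}_{s̃ₖ})] = √(2/π)∫₀^∞ E[exp(−½Σₖ(s̃ₖ₊₁−s̃ₖ)Y²_{tₖ}) | Y₀=y] y² dy`,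
written out via the joint densities. Here `x 0, …, x (n-1)` play the roles of
`x₁, …, xₙ` and `y 0, …, y n` of `y₀, …, yₙ`. -/
theorem statement3 (n : ℕ) (hn : 1 ≤ n) (s t : ℕ → ℝ)
    (hs0 : s 0 = 0) (hs1 : s (n + 1) = 1) (hsmono : ∀ k ≤ n, s k < s (k + 1))
    (ht0 : t 0 = 0) (htmono : ∀ k < n, t k < t (k + 1)) :
    Integrable
      (fun x : Fin n → ℝ =>
        Real.exp (-(∑ k ∈ Finset.range n, (t (k + 1) - t k) * ext n x k)) *
          (Real.sqrt (8 * Real.pi) * hexc (s 1) (ext n x 0) * hexc (1 - s 1) (ext n x 0)) *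
          ∏ k ∈ Finset.range (n - 1),
            (hexc (s (k + 2)) (ext n x (k + 1)) / hexc (s (k + 1)) (ext n x k)) *
              ptilde (s (k + 2) - s (k + 1)) (ext n x k) (ext n x (k + 1)))
      (Measure.pi fun _ : Fin n => volume.restrict (Set.Ioi (0 : ℝ))) ∧
    Integrable
      (fun y : Fin (n + 1) → ℝ =>
        Real.exp (-(1 / 2) * ∑ k ∈ Finset.range (n + 1),
            (s (k + 1) - s k) * (ext (n + 1) y k) ^ 2) *
          (∏ k ∈ Finset.range n,
            qrad (t (k + 1) - t k) (ext (n + 1) y k) (ext (n + 1) y (k + 1))) *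
          (ext (n + 1) y 0) ^ 2)
      (Measure.pi fun _ : Fin (n + 1) => volume.restrict (Set.Ioi (0 : ℝ))) ∧
    (∫ x : Fin n → ℝ,
        Real.exp (-(∑ k ∈ Finset.range n, (t (k + 1) - t k) * ext n x k)) *
          (Real.sqrt (8 * Real.pi) * hexc (s 1) (ext n x 0) * hexc (1 - s 1) (ext n x 0)) *
          ∏ k ∈ Finset.range (n - 1),
            (hexc (s (k + 2)) (ext n x (k + 1)) / hexc (s (k + 1)) (ext n x k)) *
              ptilde (s (k + 2) - s (k + 1)) (ext n x k) (ext n x (k + 1))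
        ∂(Measure.pi fun _ : Fin n => volume.restrict (Set.Ioi (0 : ℝ))))
      = Real.sqrt (2 / Real.pi) *
        ∫ y : Fin (n + 1) → ℝ,
          Real.exp (-(1 / 2) * ∑ k ∈ Finset.range (n + 1),
              (s (k + 1) - s k) * (ext (n + 1) y k) ^ 2) *
            (∏ k ∈ Finset.range n,
              qrad (t (k + 1) - t k) (ext (n + 1) y k) (ext (n + 1) y (k + 1))) *
            (ext (n + 1) y 0) ^ 2
          ∂(Measure.pi fun _ : Fin (n + 1) => volume.restrict (Set.Ioi (0 : ℝ))) := by
  obtain ⟨m, rfl⟩ : ∃ m, n = m + 1 := ⟨n - 1, by omega⟩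
  have hu : ∀ k ≤ m + 1, 0 < s (k + 1) - s k := fun k hk => sub_pos.mpr (hsmono k hk)
  have hc : ∀ k < m + 1, 0 < t (k + 1) - t k := fun k hk => sub_pos.mpr (htmono k hk)
  have hslt : ∀ j ≤ m, s (m + 1 - j) < 1 := by
    intro j hj
    induction j with
    | zero => exact hs1 ▸ hsmono (m + 1) le_rfl
    | succ j ih =>
      have h := hsmono (m + 1 - (j + 1)) (by omega)
      rw [show m + 1 - (j + 1) + 1 = m + 1 - j by omega] at h
      exact h.trans (ih (by omega))
  have hint := integrable_dualKernel hn hu hc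
  have hL : ∀ᵐ x ∂(Measure.pi fun _ : Fin (m + 1) => volume.restrict (Set.Ioi (0 : ℝ))),
      Real.sqrt (2 / Real.pi) * (2 / Real.pi) ^ (m + 1) *
        ∫ y, dualKernel (m + 1) (fun k => s (k + 1) - s k) (fun k => t (k + 1) - t k) x y
          ∂(Measure.pi fun _ : Fin (m + 1 + 1) => volume.restrict (Set.Ioi (0 : ℝ))) =
      Real.exp (-(∑ k ∈ Finset.range (m + 1), (t (k + 1) - t k) * ext (m + 1) x k)) *
        (Real.sqrt (8 * Real.pi) * hexc (s 1) (ext (m + 1) x 0) *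
          hexc (1 - s 1) (ext (m + 1) x 0)) *
        ∏ k ∈ Finset.range (m + 1 - 1),
          (hexc (s (k + 2)) (ext (m + 1) x (k + 1)) / hexc (s (k + 1)) (ext (m + 1) x k)) *
            ptilde (s (k + 2) - s (k + 1)) (ext (m + 1) x k) (ext (m + 1) x (k + 1)) := by
    filter_upwards [ae_ext_pos (m + 1)] with x hx
    rw [integral_dualKernel_right m hu, Nat.add_sub_cancel, Finset.prod_mul_distrib,
      Finset.prod_mul_distrib, Finset.prod_const, Finset.card_range, ← Finset.sum_neg_distrib,
      Real.exp_sum, hs0, hs1, sub_zero, sub_sub_cancel]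
    have htel := mul_prod_range_div_telescope (m := m)
      (f := fun k => hexc (s (k + 1)) (ext (m + 1) x k)) fun k hk =>
        hexc_ne_zero (by simpa [show m + 1 - (m - k) = k + 1 by omega] using hslt (m - k) (by omega))
          (hx k (by omega))
    simp only [zero_add, add_assoc, one_add_one_eq_two] at htel ⊢
    rw [← htel]
    have h8 : Real.sqrt (8 * Real.pi) = 2 * Real.pi * Real.sqrt (2 / Real.pi) := by
      rw [Real.sqrt_eq_iff_mul_self_eq_of_pos (by positivity), mul_mul_mul_comm,
        Real.mul_self_sqrt (by positivity)]
      field_simp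
      ring
    have hpow : (2 / Real.pi) ^ (m + 1) * (Real.pi / 2) ^ m = 2 / Real.pi := by
      rw [pow_succ, mul_right_comm, ← mul_pow]
      field_simp
      simp
    have hpi : 2 / Real.pi * Real.pi = 2 := div_mul_cancel₀ _ Real.pi_ne_zero
    rw [h8]
    generalize ∏ k ∈ Finset.range (m + 1), Real.exp (-((t (k + 1) - t k) * ext (m + 1) x k)) = A
    generalize ∏ k ∈ Finset.range m,
      ptilde (s (k + 2) - s (k + 1)) (ext (m + 1) x k) (ext (m + 1) x (k + 1)) = B
    generalize ∏ k ∈ Finset.range m,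
      hexc (s (k + 2)) (ext (m + 1) x (k + 1)) / hexc (s (k + 1)) (ext (m + 1) x k) = C
    generalize hexc (s 1) (ext (m + 1) x 0) = D
    generalize hexc (1 - s 1) (ext (m + 1) x 0) = E
    generalize Real.sqrt (2 / Real.pi) = r
    linear_combination (r * A * B * C * D * E * Real.pi ^ 2) * hpow +
      (r * A * B * C * D * E * Real.pi) * hpi
  have hR : ∀ᵐ y ∂(Measure.pi fun _ : Fin (m + 1 + 1) => volume.restrict (Set.Ioi (0 : ℝ))),
      (2 / Real.pi) ^ (m + 1) *
        ∫ x, dualKernel (m + 1) (fun k => s (k + 1) - s k) (fun k => t (k + 1) - t k) x y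
          ∂(Measure.pi fun _ : Fin (m + 1) => volume.restrict (Set.Ioi (0 : ℝ))) =
      Real.exp (-(1 / 2) * ∑ k ∈ Finset.range (m + 1 + 1),
          (s (k + 1) - s k) * (ext (m + 1 + 1) y k) ^ 2) *
        (∏ k ∈ Finset.range (m + 1),
          qrad (t (k + 1) - t k) (ext (m + 1 + 1) y k) (ext (m + 1 + 1) y (k + 1))) *
        (ext (m + 1 + 1) y 0) ^ 2 := by
    filter_upwards [ae_ext_pos (m + 1 + 1)] with y hy
    rw [integral_dualKernel_left (m + 1) _ hc, Finset.mul_sum, Real.exp_sum]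
    have hexp : ∀ k, Real.exp (-((s (k + 1) - s k) / 2 * ext (m + 1 + 1) y k ^ 2)) =
        Real.exp (-(1 / 2) * ((s (k + 1) - s k) * ext (m + 1 + 1) y k ^ 2)) := by
      intro k
      congr 1
      ring
    have htel := mul_prod_range_div_telescope (m := m + 1) (f := ext (m + 1 + 1) y)
      fun k hk => (hy k (by omega)).ne'
    have hq : ∏ k ∈ Finset.range (m + 1),
        qrad (t (k + 1) - t k) (ext (m + 1 + 1) y k) (ext (m + 1 + 1) y (k + 1)) =
        (∏ k ∈ Finset.range (m + 1), ext (m + 1 + 1) y (k + 1) / ext (m + 1 + 1) y k) *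
        ((2 / Real.pi) ^ (m + 1) * ∏ k ∈ Finset.range (m + 1), ((1 / 2) *
          ((t (k + 1) - t k) / ((t (k + 1) - t k) ^ 2 +
              (ext (m + 1 + 1) y k - ext (m + 1 + 1) y (k + 1)) ^ 2) -
            (t (k + 1) - t k) / ((t (k + 1) - t k) ^ 2 +
              (ext (m + 1 + 1) y k + ext (m + 1 + 1) y (k + 1)) ^ 2)))) := by
      have hpow : (2 / Real.pi) ^ (m + 1) = ∏ _k ∈ Finset.range (m + 1), 2 / Real.pi := by
        rw [Finset.prod_const, Finset.card_range]
      rw [hpow, ← Finset.prod_mul_distrib, ← Finset.prod_mul_distrib]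
      refine Finset.prod_congr rfl fun k _ => ?_
      unfold qrad
      ring
    simp_rw [hexp]
    rw [hq, ← htel]
    ring
  refine ⟨(hint.integral_prod_left.const_mul _).congr hL,
    (hint.integral_prod_right.const_mul _).congr hR, ?_⟩
  rw [← integral_congr_ae hL, ← integral_congr_ae hR, integral_const_mul, integral_const_mul,
    integral_integral_swap hint, mul_assoc]
end

section
/- For every t > 0 and every y₁ > 0, ∫₀^∞ q_t(y₁, y₂) dy₂ = 1; that is, q_t(y₁,·) is a probability density on (0,∞) (the radial part of a three-dimensional Cauchy process is a conservative Markov process). -/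
open MeasureTheory

open Filter Topology

/-- An antiderivative of `qrad t a` vanishing at `0`. -/
noncomputable def qradPrimitive (t a y : ℝ) : ℝ :=
  1 / (Real.pi * a) *
    (t / 2 * (Real.log (t ^ 2 + (y - a) ^ 2) - Real.log (t ^ 2 + (y + a) ^ 2)) +
      a * (Real.arctan ((y - a) / t) + Real.arctan ((y + a) / t)))

theorem qradPrimitive_zero (t a : ℝ) : qradPrimitive t a 0 = 0 := by
  simp [qradPrimitive, neg_div, Real.arctan_neg]

theorem hasDerivAt_log_sq_add_sq {t : ℝ} (ht : 0 < t) (c y : ℝ) :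
    HasDerivAt (fun y => Real.log (t ^ 2 + (y + c) ^ 2))
      (2 * (y + c) / (t ^ 2 + (y + c) ^ 2)) y := by
  have h : HasDerivAt (fun y : ℝ => t ^ 2 + (y + c) ^ 2) (2 * (y + c)) y := by
    simpa using (((hasDerivAt_id y).add_const c).pow 2).const_add (t ^ 2)
  exact h.log (by positivity)

theorem hasDerivAt_arctan_add_div {t : ℝ} (ht : 0 < t) (c y : ℝ) :
    HasDerivAt (fun y => Real.arctan ((y + c) / t)) (t / (t ^ 2 + (y + c) ^ 2)) y := by
  have h := (((hasDerivAt_id y).add_const c).div_const t).arctan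
  simp only [id] at h
  convert h using 1
  have : t ^ 2 + (y + c) ^ 2 ≠ 0 := by positivity
  field_simp

theorem hasDerivAt_qradPrimitive {t a : ℝ} (ht : 0 < t) (ha : 0 < a) (y : ℝ) :
    HasDerivAt (qradPrimitive t a) (qrad t a y) y := by
  have h := ((((hasDerivAt_log_sq_add_sq ht (-a) y).sub
    (hasDerivAt_log_sq_add_sq ht a y)).const_mul (t / 2)).add
    (((hasDerivAt_arctan_add_div ht (-a) y).add
      (hasDerivAt_arctan_add_div ht a y)).const_mul a)).const_mul (1 / (Real.pi * a))
  simp only [← sub_eq_add_neg] at h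
  refine h.congr_deriv ?_
  have h₁ : t ^ 2 + (y - a) ^ 2 ≠ 0 := by positivity
  have h₂ : t ^ 2 + (y + a) ^ 2 ≠ 0 := by positivity
  rw [qrad, show a - y = -(y - a) by ring, neg_sq, add_comm a y]
  field_simp
  ring

theorem tendsto_log_sub_log_atTop {t a : ℝ} (ht : 0 < t) (ha : 0 < a) :
    Tendsto (fun y => Real.log (t ^ 2 + (y - a) ^ 2) - Real.log (t ^ 2 + (y + a) ^ 2))
      atTop (𝓝 0) := by
  have hq : Tendsto (fun y => 4 * a * y / (t ^ 2 + (y + a) ^ 2)) atTop (𝓝 0) := by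
    refine squeeze_zero' (g := fun y => 4 * a / y) ?_ ?_ (tendsto_const_nhds.div_atTop tendsto_id)
    · filter_upwards [eventually_gt_atTop 0] with y hy
      positivity
    · filter_upwards [eventually_gt_atTop 0] with y hy
      rw [div_le_div_iff₀ (by positivity) hy, mul_assoc]
      gcongr
      nlinarith [mul_pos hy ha, sq_nonneg t, sq_nonneg a]
  have hl := (hq.const_sub 1).log (by norm_num)
  simp only [sub_zero, Real.log_one] at hl
  refine hl.congr fun y => ?_
  rw [← Real.log_div (by positivity) (by positivity)]
  congr 1
  have : t ^ 2 + (y + a) ^ 2 ≠ 0 := by positivity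
  field_simp
  ring

theorem tendsto_arctan_add_div_atTop {t : ℝ} (ht : 0 < t) (c : ℝ) :
    Tendsto (fun y => Real.arctan ((y + c) / t)) atTop (𝓝 (Real.pi / 2)) :=
  (Real.tendsto_arctan_atTop.mono_right nhdsWithin_le_nhds).comp
    ((tendsto_atTop_add_const_right atTop c tendsto_id).atTop_div_const ht)

theorem tendsto_qradPrimitive_atTop {t a : ℝ} (ht : 0 < t) (ha : 0 < a) :
    Tendsto (qradPrimitive t a) atTop (𝓝 1) := by
  have h := (((tendsto_log_sub_log_atTop ht ha).const_mul (t / 2)).add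
    (((tendsto_arctan_add_div_atTop ht (-a)).add
      (tendsto_arctan_add_div_atTop ht a)).const_mul a)).const_mul (1 / (Real.pi * a))
  simp only [← sub_eq_add_neg] at h
  have hlim : 1 / (Real.pi * a) * (t / 2 * 0 + a * (Real.pi / 2 + Real.pi / 2)) = 1 := by
    have := Real.pi_ne_zero
    field_simp
    ring
  rwa [hlim] at h

theorem qrad_nonneg {t a y : ℝ} (ht : 0 < t) (ha : 0 < a) (hy : 0 < y) : 0 ≤ qrad t a y := by
  have hπ := Real.pi_pos
  refine mul_nonneg (by positivity) (sub_nonneg.2 ?_)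
  refine div_le_div_of_nonneg_left ht.le (by positivity) ?_
  nlinarith [mul_pos ha hy]

/-- `q_t(y₁,·)` is a probability density on `(0,∞)`. -/
theorem statement13 (t : ℝ) (ht : 0 < t) (y₁ : ℝ) (hy₁ : 0 < y₁) :
    IntegrableOn (fun y₂ : ℝ => qrad t y₁ y₂) (Set.Ioi 0) ∧
    ∫ y₂ in Set.Ioi (0 : ℝ), qrad t y₁ y₂ = 1 := by
  have hd : ∀ y ∈ Set.Ici (0 : ℝ), HasDerivAt (qradPrimitive t y₁) (qrad t y₁ y) y :=
    fun y _ => hasDerivAt_qradPrimitive ht hy₁ y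
  have hn : ∀ y ∈ Set.Ioi (0 : ℝ), 0 ≤ qrad t y₁ y := fun y hy => qrad_nonneg ht hy₁ hy
  have hl := tendsto_qradPrimitive_atTop ht hy₁
  refine ⟨integrableOn_Ioi_deriv_of_nonneg' hd hn hl, ?_⟩
  rw [integral_Ioi_of_hasDerivAt_of_nonneg' hd hn hl, qradPrimitive_zero, sub_zero]
end

section
/- For every t > 0 and all y₁, y₂ ∈ ℝ, ∫_{−∞}^{∞} e^{t x} · K_{iy₁}(e^{x}) · K_{iy₂}(e^{x}) dx = (2^{t−3} / Γ(t)) · Γ((t + i(y₁+y₂))/2) · Γ((t − i(y₁+y₂))/2) · Γ((t + i(y₁−y₂))/2) · Γ((t − i(y₁−y₂))/2), where Γ is the complex Gamma function; the right-hand side equals (2^{t−3}/Γ(t))·|Γ((t+i(y₁+y₂))/2) Γ((t+i(y₁−y₂))/2)|². -/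
open MeasureTheory

/-- Modified Bessel function of the second kind of imaginary order:
`K_{iy}(z) = ∫₀^∞ exp(−z cosh u) cos(yu) du`. -/
noncomputable def Kim (y z : ℝ) : ℝ :=
  ∫ u in Set.Ioi (0 : ℝ), Real.exp (-z * Real.cosh u) * Real.cos (y * u)

/-- The function whose integral over the line is a Beta integral in disguise:
`a ↦ (cosh a)^(-t) e^{isa}`. -/
noncomputable def coshPowExp (t s a : ℝ) : ℂ :=
  ((Real.cosh a ^ (-t) : ℝ) : ℂ) * Complex.exp (Complex.I * s * a)

lemma norm_exp_I_mul_mul (s a : ℝ) : ‖Complex.exp (Complex.I * s * a)‖ = 1 := by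
  rw [Complex.norm_exp]; simp

lemma sigmoid_two_mul (a : ℝ) :
    Real.sigmoid (2 * a) = Real.exp (a - Real.log (2 * Real.cosh a)) := by
  have hc := Real.cosh_pos a
  rw [Real.exp_sub, Real.exp_log (by positivity), Real.sigmoid_def, Real.cosh_eq]
  have h : Real.exp (-(2 * a)) = Real.exp (-a) / Real.exp a := by rw [← Real.exp_sub]; ring_nf
  rw [h]
  field_simp

lemma one_sub_sigmoid_two_mul (a : ℝ) :
    1 - Real.sigmoid (2 * a) = Real.exp (-a - Real.log (2 * Real.cosh a)) := by
  rw [← Real.sigmoid_neg, ← mul_neg, sigmoid_two_mul, Real.cosh_neg]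

lemma ofReal_exp_cpow (x : ℝ) (w : ℂ) : ((Real.exp x : ℝ) : ℂ) ^ w = Complex.exp (x * w) := by
  rw [Complex.cpow_def_of_ne_zero (by exact_mod_cast (Real.exp_pos x).ne'),
    ← Complex.ofReal_log (Real.exp_pos x).le, Real.log_exp]

lemma beta_integrand_comp_sigmoid (t s a : ℝ) :
    |2 * (Real.sigmoid (2 * a) * (1 - Real.sigmoid (2 * a)))| •
      (((Real.sigmoid (2 * a) : ℝ) : ℂ) ^ (((t : ℂ) + Complex.I * s) / 2 - 1) *
        (1 - ((Real.sigmoid (2 * a) : ℝ) : ℂ)) ^ (((t : ℂ) - Complex.I * s) / 2 - 1)) =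
      ((2 ^ (1 - t) : ℝ) : ℂ) * coshPowExp t s a := by
  have hc := Real.cosh_pos a
  have h1 : (1 - ((Real.sigmoid (2 * a) : ℝ) : ℂ)) = ((1 - Real.sigmoid (2 * a) : ℝ) : ℂ) := by
    push_cast; rfl
  rw [h1, one_sub_sigmoid_two_mul, sigmoid_two_mul, abs_of_pos (by positivity), coshPowExp,
    ofReal_exp_cpow, ofReal_exp_cpow, Real.rpow_sub two_pos, Real.rpow_one,
    Real.rpow_def_of_pos two_pos, Real.rpow_def_of_pos hc, Complex.real_smul,
    Real.log_mul two_ne_zero hc.ne', div_eq_mul_inv 2 (Real.exp _), ← Real.exp_neg]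
  push_cast
  simp only [mul_assoc, ← Complex.exp_add]
  congr 2
  ring

lemma hasDerivWithinAt_sigmoid_two_mul (a : ℝ) (s : Set ℝ) :
    HasDerivWithinAt (fun a : ℝ => Real.sigmoid (2 * a))
      (2 * (Real.sigmoid (2 * a) * (1 - Real.sigmoid (2 * a)))) s a := by
  have h := (Real.hasDerivAt_sigmoid (2 * a)).comp a ((hasDerivAt_id a).const_mul 2)
  exact (h.congr_deriv (by ring)).hasDerivWithinAt

lemma image_sigmoid_two_mul :
    (fun a : ℝ => Real.sigmoid (2 * a)) '' Set.univ = Set.Ioo 0 1 := by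
  rw [Set.image_univ, ← Real.range_sigmoid]
  exact (mul_left_surjective₀ (two_ne_zero' ℝ)).range_comp Real.sigmoid

lemma injOn_sigmoid_two_mul :
    Set.InjOn (fun a : ℝ => Real.sigmoid (2 * a)) Set.univ := fun a _ b _ h => by
  simpa using Real.sigmoid_injective h

lemma re_half_add_pos {t : ℝ} (ht : 0 < t) (s : ℝ) :
    0 < (((t : ℂ) + Complex.I * s) / 2).re := by
  simpa using ht

lemma re_half_sub_pos {t : ℝ} (ht : 0 < t) (s : ℝ) :
    0 < (((t : ℂ) - Complex.I * s) / 2).re := by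
  simpa using ht

lemma integrable_coshPowExp {t : ℝ} (ht : 0 < t) (s : ℝ) : Integrable (coshPowExp t s) := by
  have h := Complex.betaIntegral_convergent (re_half_add_pos ht s) (re_half_sub_pos ht s)
  rw [intervalIntegrable_iff_integrableOn_Ioo_of_le zero_le_one, ← image_sigmoid_two_mul,
    integrableOn_image_iff_integrableOn_abs_deriv_smul MeasurableSet.univ
      (fun a _ => hasDerivWithinAt_sigmoid_two_mul a _) injOn_sigmoid_two_mul,
    integrableOn_univ] at h
  simp only [beta_integrand_comp_sigmoid] at h
  have h2 : ((2 ^ (1 - t) : ℝ) : ℂ) ≠ 0 :=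
    Complex.ofReal_ne_zero.2 (Real.rpow_pos_of_pos two_pos _).ne'
  simpa [mul_assoc, h2] using h.const_mul ((2 ^ (1 - t) : ℝ) : ℂ)⁻¹

lemma integral_coshPowExp {t : ℝ} (ht : 0 < t) (s : ℝ) :
    ∫ a, coshPowExp t s a = ((2 ^ (t - 1) : ℝ) : ℂ) / Complex.Gamma t *
      Complex.Gamma (((t : ℂ) + Complex.I * s) / 2) *
      Complex.Gamma (((t : ℂ) - Complex.I * s) / 2) := by
  have h := Complex.Gamma_mul_Gamma_eq_betaIntegral (re_half_add_pos ht s) (re_half_sub_pos ht s)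
  rw [Complex.betaIntegral, intervalIntegral.integral_of_le zero_le_one,
    integral_Ioc_eq_integral_Ioo, ← image_sigmoid_two_mul,
    integral_image_eq_integral_abs_deriv_smul MeasurableSet.univ
      (fun a _ => hasDerivWithinAt_sigmoid_two_mul a _) injOn_sigmoid_two_mul,
    setIntegral_univ] at h
  simp only [beta_integrand_comp_sigmoid] at h
  rw [integral_const_mul, show ((t : ℂ) + Complex.I * s) / 2 + ((t : ℂ) - Complex.I * s) / 2 = t by
    ring] at h
  have hG : Complex.Gamma t ≠ 0 := Complex.Gamma_ne_zero_of_re_pos (by simpa using ht)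
  have h2 : ((2 ^ (t - 1) : ℝ) : ℂ) * ((2 ^ (1 - t) : ℝ) : ℂ) = 1 := by
    rw [← Complex.ofReal_mul, ← Real.rpow_add two_pos]; simp
  rw [mul_assoc, h]
  field_simp
  rw [mul_assoc, h2, mul_one]

lemma integrable_cosh_rpow_neg {t : ℝ} (ht : 0 < t) :
    Integrable (fun a : ℝ => Real.cosh a ^ (-t)) := by
  have h := (integrable_coshPowExp ht 0).re
  simpa [coshPowExp] using h

lemma integral_exp_mul_exp_neg_exp {t c : ℝ} (ht : 0 < t) (hc : 0 < c) :
    ∫ x : ℝ, Real.exp (t * x) * Real.exp (-Real.exp x * c) = Real.Gamma t * c ^ (-t) := by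
  have h := Real.integral_rpow_mul_exp_neg_mul_Ioi ht hc
  rw [← Real.range_exp, ← Set.image_univ,
    integral_image_eq_integral_abs_deriv_smul MeasurableSet.univ
      (fun x _ => (Real.hasDerivAt_exp x).hasDerivWithinAt) Real.exp_injective.injOn,
    setIntegral_univ] at h
  rw [Real.rpow_neg hc.le, ← Real.inv_rpow hc.le, mul_comm (Real.Gamma t), ← one_div, ← h]
  refine integral_congr_ae (.of_forall fun x => ?_)
  simp only [smul_eq_mul, abs_of_pos (Real.exp_pos x), ← Real.exp_mul, ← Real.exp_add]
  ring_nf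

lemma integrable_exp_mul_exp_neg_exp {t c : ℝ} (ht : 0 < t) (hc : 0 < c) :
    Integrable (fun x : ℝ => Real.exp (t * x) * Real.exp (-Real.exp x * c)) := by
  refine .of_integral_ne_zero ?_
  rw [integral_exp_mul_exp_neg_exp ht hc]
  exact (mul_pos (Real.Gamma_pos_of_pos ht) (Real.rpow_pos_of_pos hc _)).ne'

lemma integrable_exp_neg_mul_cosh {z : ℝ} (hz : 0 < z) :
    Integrable (fun u : ℝ => Real.exp (-z * Real.cosh u)) := by
  refine ((integrable_cosh_rpow_neg one_pos).const_mul z⁻¹).mono'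
    (by fun_prop) (.of_forall fun u => ?_)
  have hc := Real.cosh_pos u
  rw [Real.norm_eq_abs, Real.abs_exp, Real.rpow_neg_one, ← mul_inv, neg_mul, Real.exp_neg]
  have := Real.add_one_le_exp (z * Real.cosh u)
  gcongr
  linarith

lemma two_mul_Kim (y : ℝ) {z : ℝ} (hz : 0 < z) :
    ((2 * Kim y z : ℝ) : ℂ) =
      ∫ u : ℝ, (Real.exp (-z * Real.cosh u) : ℂ) * Complex.exp (Complex.I * y * u) := by
  have hint (y : ℝ) : Integrable (fun u : ℝ =>
      (Real.exp (-z * Real.cosh u) : ℂ) * Complex.exp (Complex.I * y * u)) := by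
    refine (integrable_exp_neg_mul_cosh hz).mono' (by fun_prop) (.of_forall fun u => ?_)
    rw [norm_mul, norm_exp_I_mul_mul, mul_one, Complex.norm_real, Real.norm_eq_abs, Real.abs_exp]
  have hneg := integral_neg_eq_self (μ := volume) (fun u : ℝ =>
      (Real.exp (-z * Real.cosh u) : ℂ) * Complex.exp (Complex.I * y * u))
  have habs : 2 * Kim y z = ∫ u : ℝ, Real.exp (-z * Real.cosh u) * Real.cos (y * u) := by
    rw [Kim, ← integral_comp_abs
      (f := fun u => Real.exp (-z * Real.cosh u) * Real.cos (y * u))]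
    refine integral_congr_ae (.of_forall fun u => ?_)
    rcases abs_choice u with h | h <;> simp [h]
  have hadd := integral_add (hint y) (hint y).comp_neg
  rw [hneg, ← two_mul] at hadd
  rw [habs, ← integral_complex_ofReal, ← mul_right_inj' (two_ne_zero' ℂ), ← hadd,
    ← integral_const_mul]
  refine integral_congr_ae (.of_forall fun u => ?_)
  simp only [Complex.ofReal_mul, Complex.ofReal_cos, Real.cosh_neg, Complex.ofReal_neg,
    Complex.cos]
  ring_nf

/-- The integrand of the triple integral, in the variables `x` and `(u, v)`. -/
noncomputable def tripleIntegrand (t y₁ y₂ : ℝ) (q : ℝ × (ℝ × ℝ)) : ℂ :=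
  ((Real.exp (t * q.1) *
      Real.exp (-Real.exp q.1 * (Real.cosh q.2.1 + Real.cosh q.2.2)) : ℝ) : ℂ) *
    (Complex.exp (Complex.I * y₁ * q.2.1) * Complex.exp (Complex.I * y₂ * q.2.2))

lemma norm_tripleIntegrand (t y₁ y₂ : ℝ) (q : ℝ × (ℝ × ℝ)) :
    ‖tripleIntegrand t y₁ y₂ q‖ = Real.exp (t * q.1) *
      Real.exp (-Real.exp q.1 * (Real.cosh q.2.1 + Real.cosh q.2.2)) := by
  rw [tripleIntegrand, norm_mul, norm_mul, norm_exp_I_mul_mul, norm_exp_I_mul_mul, mul_one,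
    mul_one, Complex.norm_real, Real.norm_of_nonneg (by positivity)]

lemma cosh_add_cosh_pos (u v : ℝ) : 0 < Real.cosh u + Real.cosh v :=
  add_pos (Real.cosh_pos u) (Real.cosh_pos v)

lemma integrable_cosh_add_cosh_rpow_neg {t : ℝ} (ht : 0 < t) :
    Integrable (fun p : ℝ × ℝ => (Real.cosh p.1 + Real.cosh p.2) ^ (-t)) := by
  have h := integrable_cosh_rpow_neg (half_pos ht)
  rw [Measure.volume_eq_prod]
  refine (h.mul_prod h).mono' ?_ (.of_forall fun p => ?_)
  · have hc : Continuous fun p : ℝ × ℝ => Real.cosh p.1 + Real.cosh p.2 := by fun_prop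
    exact (hc.measurable.pow_const (-t)).aestronglyMeasurable
  · have h1 := Real.one_le_cosh p.1
    have h2 := Real.one_le_cosh p.2
    rw [Real.norm_of_nonneg (by positivity), ← Real.mul_rpow (by positivity) (by positivity),
      show -t = 2 * -(t / 2) by ring, Real.rpow_mul (by positivity)]
    refine Real.rpow_le_rpow_of_nonpos (by positivity) ?_ (by linarith)
    rw [Real.rpow_two]
    nlinarith

lemma integrable_tripleIntegrand {t : ℝ} (ht : 0 < t) (y₁ y₂ : ℝ) :
    Integrable (tripleIntegrand t y₁ y₂) (volume.prod volume) := by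
  have hm : Continuous (tripleIntegrand t y₁ y₂) := by unfold tripleIntegrand; fun_prop
  rw [integrable_prod_iff' hm.aestronglyMeasurable]
  simp only [norm_tripleIntegrand]
  constructor
  · refine .of_forall fun p => ?_
    refine (integrable_exp_mul_exp_neg_exp ht (cosh_add_cosh_pos p.1 p.2)).mono'
      (by fun_prop) (.of_forall fun x => (norm_tripleIntegrand ..).le)
  · simp only [integral_exp_mul_exp_neg_exp ht (cosh_add_cosh_pos _ _)]
    exact (integrable_cosh_add_cosh_rpow_neg ht).const_mul _

lemma integral_tripleIntegrand_uv (t y₁ y₂ x : ℝ) :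
    ∫ p, tripleIntegrand t y₁ y₂ (x, p) =
      4 * ((Real.exp (t * x) * Kim y₁ (Real.exp x) * Kim y₂ (Real.exp x) : ℝ) : ℂ) := by
  have h : 4 * ((Real.exp (t * x) * Kim y₁ (Real.exp x) * Kim y₂ (Real.exp x) : ℝ) : ℂ) =
      (Real.exp (t * x) : ℂ) * (((2 * Kim y₁ (Real.exp x) : ℝ) : ℂ) *
        ((2 * Kim y₂ (Real.exp x) : ℝ) : ℂ)) := by push_cast; ring
  rw [h, two_mul_Kim _ (Real.exp_pos x), two_mul_Kim _ (Real.exp_pos x), ← integral_prod_mul,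
    ← integral_const_mul]
  refine integral_congr_ae (.of_forall fun p => ?_)
  simp only [tripleIntegrand, mul_add, Real.exp_add]
  push_cast
  ring

lemma integral_tripleIntegrand_x {t : ℝ} (ht : 0 < t) (y₁ y₂ : ℝ) (p : ℝ × ℝ) :
    ∫ x, tripleIntegrand t y₁ y₂ (x, p) = (Real.Gamma t : ℂ) *
      ((((Real.cosh p.1 + Real.cosh p.2) ^ (-t) : ℝ) : ℂ) *
        (Complex.exp (Complex.I * y₁ * p.1) * Complex.exp (Complex.I * y₂ * p.2))) := by
  simp only [tripleIntegrand]
  rw [integral_mul_const, integral_complex_ofReal,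
    integral_exp_mul_exp_neg_exp ht (cosh_add_cosh_pos _ _)]
  push_cast
  ring

lemma cosh_add_cosh_rpow_mul_exp (t y₁ y₂ u b : ℝ) :
    (((Real.cosh u + Real.cosh (u - 2 * b)) ^ (-t) : ℝ) : ℂ) *
        (Complex.exp (Complex.I * y₁ * u) * Complex.exp (Complex.I * y₂ * (u - 2 * b : ℝ))) =
      ((2 ^ (-t) : ℝ) : ℂ) * (coshPowExp t (y₁ - y₂) b * coshPowExp t (y₁ + y₂) (u - b)) := by
  have h : Real.cosh u + Real.cosh (u - 2 * b) = 2 * (Real.cosh b * Real.cosh (u - b)) := by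
    rw [show Real.cosh u = Real.cosh ((u - b) + b) by ring_nf,
      show u - 2 * b = (u - b) - b by ring, Real.cosh_add, Real.cosh_sub (u - b)]
    ring
  have hb := Real.cosh_pos b
  have hu := Real.cosh_pos (u - b)
  rw [h, Real.mul_rpow two_pos.le (by positivity), Real.mul_rpow hb.le hu.le, ← Complex.exp_add,
    coshPowExp, coshPowExp]
  have he : Complex.I * y₁ * u + Complex.I * y₂ * (u - 2 * b : ℝ) =
      Complex.I * (y₁ - y₂ : ℝ) * b + Complex.I * (y₁ + y₂ : ℝ) * (u - b : ℝ) := by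
    push_cast; ring
  rw [he, Complex.exp_add]
  push_cast
  ring

lemma integral_cosh_add_cosh_rpow_mul_exp {t : ℝ} (ht : 0 < t) (y₁ y₂ : ℝ) :
    ∫ p : ℝ × ℝ, (((Real.cosh p.1 + Real.cosh p.2) ^ (-t) : ℝ) : ℂ) *
        (Complex.exp (Complex.I * y₁ * p.1) * Complex.exp (Complex.I * y₂ * p.2)) =
      ((2 ^ (1 - t) : ℝ) : ℂ) *
        ((∫ b, coshPowExp t (y₁ - y₂) b) * ∫ a, coshPowExp t (y₁ + y₂) a) := by
  have hint : Integrable (fun p : ℝ × ℝ => (((Real.cosh p.1 + Real.cosh p.2) ^ (-t) : ℝ) : ℂ) *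
      (Complex.exp (Complex.I * y₁ * p.1) * Complex.exp (Complex.I * y₂ * p.2))) := by
    have h := (integrable_cosh_add_cosh_rpow_neg ht).ofReal (𝕜 := ℂ)
    refine h.mul_bdd (c := 1) (by fun_prop) (.of_forall fun p => ?_)
    rw [norm_mul, norm_exp_I_mul_mul, norm_exp_I_mul_mul, mul_one]
  have hinner (u : ℝ) : ∫ v : ℝ, (((Real.cosh u + Real.cosh v) ^ (-t) : ℝ) : ℂ) *
      (Complex.exp (Complex.I * y₁ * u) * Complex.exp (Complex.I * y₂ * v)) =
      ((2 ^ (1 - t) : ℝ) : ℂ) *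
        ∫ b, coshPowExp t (y₁ - y₂) b * coshPowExp t (y₁ + y₂) (u - b) := by
    rw [← integral_sub_left_eq_self _ volume u]
    have hscale := Measure.integral_comp_mul_left (fun v : ℝ =>
      (((Real.cosh u + Real.cosh (u - v)) ^ (-t) : ℝ) : ℂ) *
        (Complex.exp (Complex.I * y₁ * u) * Complex.exp (Complex.I * y₂ * (u - v : ℝ)))) 2
    simp only [cosh_add_cosh_rpow_mul_exp, integral_const_mul] at hscale
    rw [Real.rpow_sub two_pos, div_eq_mul_inv, ← Real.rpow_neg two_pos.le, Real.rpow_one,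
      Complex.ofReal_mul, mul_assoc ((2 : ℝ) : ℂ), hscale, abs_of_pos (by norm_num), Complex.real_smul]
    push_cast
    ring
  have hconv := integral_convolution (ContinuousLinearMap.mul ℝ ℂ)
    (integrable_coshPowExp ht (y₁ - y₂)) (integrable_coshPowExp ht (y₁ + y₂))
  simp only [convolution, ContinuousLinearMap.mul_apply'] at hconv
  rw [Measure.volume_eq_prod] at hint ⊢
  rw [integral_prod _ hint]
  simp only [hinner, integral_const_mul, hconv]

/-- The Mellin transform of a product of two Bessel functions `K_{iy₁} K_{iy₂}`. -/
theorem statement16 (t : ℝ) (ht : 0 < t) (y₁ y₂ : ℝ) :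
    Integrable (fun x : ℝ => Real.exp (t * x) * Kim y₁ (Real.exp x) * Kim y₂ (Real.exp x)) ∧
    ((∫ x : ℝ, Real.exp (t * x) * Kim y₁ (Real.exp x) * Kim y₂ (Real.exp x) : ℝ) : ℂ)
      = (((2 : ℝ) ^ (t - 3) : ℝ) / Complex.Gamma (t : ℂ)) *
          Complex.Gamma (((t : ℂ) + Complex.I * ((y₁ : ℂ) + (y₂ : ℂ))) / 2) *
          Complex.Gamma (((t : ℂ) - Complex.I * ((y₁ : ℂ) + (y₂ : ℂ))) / 2) *
          Complex.Gamma (((t : ℂ) + Complex.I * ((y₁ : ℂ) - (y₂ : ℂ))) / 2) *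
          Complex.Gamma (((t : ℂ) - Complex.I * ((y₁ : ℂ) - (y₂ : ℂ))) / 2) := by
  have hI := integrable_tripleIntegrand ht y₁ y₂
  have hleft := hI.integral_prod_left
  simp only [integral_tripleIntegrand_uv] at hleft
  refine ⟨?_, ?_⟩
  · refine (hleft.re.const_mul (1 / 4)).congr (.of_forall fun x => ?_)
    simp only [RCLike.re_to_complex, Complex.re_mul_ofReal, Complex.re_ofNat]
    ring
  have hswap := integral_integral_swap (f := fun x p => tripleIntegrand t y₁ y₂ (x, p)) hI
  simp only [integral_tripleIntegrand_uv, integral_tripleIntegrand_x ht, integral_const_mul,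
    integral_cosh_add_cosh_rpow_mul_exp ht, integral_coshPowExp ht, integral_complex_ofReal]
    at hswap
  rw [← mul_right_inj' (show (4 : ℂ) ≠ 0 by norm_num), hswap, ← Complex.Gamma_ofReal]
  have hG : Complex.Gamma t ≠ 0 := Complex.Gamma_ne_zero_of_re_pos (by simpa using ht)
  have h2 : ((2 ^ (1 - t) : ℝ) : ℂ) * ((2 ^ (t - 1) : ℝ) : ℂ) * ((2 ^ (t - 1) : ℝ) : ℂ) =
      4 * ((2 ^ (t - 3) : ℝ) : ℂ) := by
    rw [show (4 : ℂ) = ((2 ^ (2 : ℝ) : ℝ) : ℂ) by norm_num]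
    simp only [← Complex.ofReal_mul, ← Real.rpow_add two_pos]
    ring_nf
  simp only [Complex.ofReal_add, Complex.ofReal_sub]
  field_simp
  linear_combination (Complex.Gamma (((t : ℂ) + Complex.I * ((y₁ : ℂ) + (y₂ : ℂ))) / 2) *
    Complex.Gamma (((t : ℂ) - Complex.I * ((y₁ : ℂ) + (y₂ : ℂ))) / 2) *
    Complex.Gamma (((t : ℂ) + Complex.I * ((y₁ : ℂ) - (y₂ : ℂ))) / 2) *
    Complex.Gamma (((t : ℂ) - Complex.I * ((y₁ : ℂ) - (y₂ : ℂ))) / 2)) * h2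
end
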